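/- arXiv:1110.1960 — 4 statements merged into one kernel-verified Lean document; each statement's English description precedes it below -/
import Mathlib

section
/- Assume 0 ≤ v(c) < p/((q+1)(p−1)) (i.e. v(c) < v(λ^{p/(1+q)})). Then every root y ∈ Ω of L_c(X) satisfies v(c + y) = v(c) and v(y) = (v(a_n) + v(c))/q² = (p(q−1)/(p−1) + v(c))/q²; in particular v(y) > 0. -/
open Polynomial

noncomputable section

/-- `K₀`: the fraction field of the Witt vectors over `𝔽̄_p`, i.e. the completion of `ℚ_p^ur`. -/
abbrev Kzero (p : ℕ) [Fact p.Prime] : Type :=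
  FractionRing (WittVector p (AlgebraicClosure (ZMod p)))

/-- `Ω`: a fixed algebraic closure of `K₀`. -/
abbrev Omg (p : ℕ) [Fact p.Prime] : Type := AlgebraicClosure (Kzero p)

/-- `a_n = (-1)^q · (-p)^(p + p² + ⋯ + pⁿ)` as an element of a commutative ring. -/
def aCoef (R : Type) [CommRing R] (p n : ℕ) : R :=
  (-1) ^ p ^ n * (-(p : R)) ^ (Finset.sum (Finset.range n) fun i => p ^ (i + 1))

/-- `f_{q,c}(X) = 1 + c·X^q + X^(1+q)` with `q = pⁿ`. -/
def fqc (R : Type) [CommRing R] (p n : ℕ) (c : R) : Polynomial R :=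
  1 + C c * X ^ p ^ n + X ^ (p ^ n + 1)

/-- The modified monodromy polynomial `L_c(X) = X^(q²) − a_n·(c+X)·f_{q,c}(X)^(q−1)`. -/
def Lpoly (R : Type) [CommRing R] (p n : ℕ) (c : R) : Polynomial R :=
  X ^ (p ^ n * p ^ n) - C (aCoef R p n) * (C c + X) * fqc R p n c ^ (p ^ n - 1)

/-- A map on a field satisfying the axioms of a rational additive valuation away from `0`;
its value at `0` is unspecified. -/
structure IsRatValuation {F : Type} [Field F] (v : F → ℚ) : Prop where
  map_mul : ∀ x y : F, x ≠ 0 → y ≠ 0 → v (x * y) = v x + v y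
  map_add : ∀ x y : F, x ≠ 0 → y ≠ 0 → x + y ≠ 0 → min (v x) (v y) ≤ v (x + y)

namespace IsRatValuation

variable {F : Type} [Field F] {v : F → ℚ}

theorem map_one (h : IsRatValuation v) : v 1 = 0 := by
  have := h.map_mul 1 1 one_ne_zero one_ne_zero
  rw [mul_one] at this
  linarith

theorem map_neg (h : IsRatValuation v) {x : F} (hx : x ≠ 0) : v (-x) = v x := by
  have h1 := h.map_mul (-1) (-1) (neg_ne_zero.2 one_ne_zero) (neg_ne_zero.2 one_ne_zero)
  rw [neg_mul_neg, mul_one, h.map_one] at h1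
  have h2 := h.map_mul (-1) x (neg_ne_zero.2 one_ne_zero) hx
  rw [neg_one_mul] at h2
  linarith

theorem map_pow (h : IsRatValuation v) {x : F} (hx : x ≠ 0) (m : ℕ) : v (x ^ m) = m * v x := by
  induction m with
  | zero => simp [h.map_one]
  | succ m ih =>
    rw [pow_succ, h.map_mul _ _ (pow_ne_zero m hx) hx, ih]
    push_cast
    ring

theorem add_ne_zero_of_lt (h : IsRatValuation v) {x y : F} (hx : x ≠ 0) (hxy : v x < v y) :
    x + y ≠ 0 := by
  intro h0
  rw [eq_neg_of_add_eq_zero_right h0, h.map_neg hx] at hxy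
  exact hxy.false

theorem map_add_of_lt (h : IsRatValuation v) {x y : F} (hx : x ≠ 0) (hy : y ≠ 0)
    (hxy : v x < v y) : v (x + y) = v x := by
  have hs := h.add_ne_zero_of_lt hx hxy
  have h1 := h.map_add x y hx hy hs
  rw [min_eq_left hxy.le] at h1
  have h2 := h.map_add (x + y) (-y) hs (neg_ne_zero.2 hy) (by simpa using hx)
  rw [add_neg_cancel_right, h.map_neg hy] at h2
  rcases min_le_iff.1 h2 with h3 | h3
  · exact le_antisymm h3 h1
  · exact absurd h3 (not_le.2 hxy)

/-- A nonzero solution of `y ^ (q * q) = a * (c + y) * (1 + c * y ^ q + y ^ (q + 1)) ^ (q - 1)`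
has the valuation predicted by the Newton polygon when `v c` is small. -/
theorem map_of_pow_eq (h : IsRatValuation v) {q : ℕ} (hq : 2 ≤ q) {a c y : F}
    (ha0 : a ≠ 0) (hc0 : c ≠ 0) (hy0 : y ≠ 0) (ha : 0 < v a) (hc : 0 ≤ v c)
    (hlt : ((q : ℚ) * q - 1) * v c < v a)
    (he : y ^ (q * q) = a * (c + y) * (1 + c * y ^ q + y ^ (q + 1)) ^ (q - 1)) :
    v (c + y) = v c ∧ 0 < v y ∧ (q : ℚ) * q * v y = v a + v c := by
  have hyq := pow_ne_zero (q * q) hy0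
  have hq2 : (2 : ℚ) ≤ q := by exact_mod_cast hq
  set f := 1 + c * y ^ q + y ^ (q + 1) with hf
  have hcy : c + y ≠ 0 := by
    intro h0
    simp [he, h0] at hyq
  have hf0 : f ≠ 0 := by
    intro h0
    rw [he, h0, zero_pow (by omega), mul_zero] at hyq
    exact hyq rfl
  have hval : (q : ℚ) * q * v y = v a + v (c + y) + (q - 1) * v f := by
    have := congrArg v he
    rw [h.map_pow hy0, h.map_mul _ _ (mul_ne_zero ha0 hcy) (pow_ne_zero _ hf0),
      h.map_mul _ _ ha0 hcy, h.map_pow hf0, Nat.cast_sub (by omega)] at this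
    push_cast at this
    exact this
  have hg0 : y ^ q * (c + y) ≠ 0 := mul_ne_zero (pow_ne_zero _ hy0) hcy
  have hfg : f = 1 + y ^ q * (c + y) := by rw [hf]; ring
  have hvg : v (y ^ q * (c + y)) = q * v y + v (c + y) := by
    rw [h.map_mul _ _ (pow_ne_zero _ hy0) hcy, h.map_pow hy0]
  have hmin := h.map_add c y hc0 hy0 hcy
  have hpos : 0 < v y := by
    by_contra! hneg
    rcases hneg.lt_or_eq with hlt0 | h0
    · have h1 : v (c + y) = v y := by
        rw [add_comm]
        exact h.map_add_of_lt hy0 hc0 (by linarith)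
      have h2 : v f = q * v y + v y := by
        rw [hfg, add_comm, h.map_add_of_lt hg0 one_ne_zero, hvg, h1]
        rw [hvg, h1, h.map_one]
        nlinarith
      rw [h1, h2] at hval
      nlinarith
    · have h1 : 0 ≤ v (c + y) := (le_min hc h0.ge).trans hmin
      have h2 : 0 ≤ v f := by
        have := h.map_add 1 _ one_ne_zero hg0 (hfg ▸ hf0)
        rw [← hfg, hvg, h.map_one, h0, mul_zero, zero_add, min_eq_left h1] at this
        exact this
      rw [h0] at hval
      nlinarith
  have hcy_nonneg : 0 ≤ v (c + y) := (le_min hc hpos.le).trans hmin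
  have hvf : v f = 0 := by
    rw [hfg, h.map_add_of_lt one_ne_zero hg0, h.map_one]
    rw [hvg, h.map_one]
    nlinarith
  rw [hvf, mul_zero, add_zero] at hval
  have hcltly : v c < v y := by
    by_contra! hle
    have h1 : v y ≤ v (c + y) := (le_min hle le_rfl).trans hmin
    nlinarith [mul_nonneg (show (0 : ℚ) ≤ q * q - 1 by nlinarith) (sub_nonneg.2 hle)]
  have hvc := h.map_add_of_lt hc0 hy0 hcltly
  exact ⟨hvc, hpos, hvc ▸ hval⟩

end IsRatValuation

theorem natCast_Omg_ne_zero (p : ℕ) [Fact p.Prime] : ((p : ℕ) : Omg p) ≠ 0 := by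
  have h0 := WittVector.p_nonzero p (AlgebraicClosure (ZMod p))
  have h1 : ((p : ℕ) : Kzero p) ≠ 0 := by
    rw [← map_natCast (algebraMap (WittVector p (AlgebraicClosure (ZMod p))) (Kzero p))]
    exact (map_ne_zero_iff _ (IsFractionRing.injective _ _)).2 h0
  rw [← map_natCast (algebraMap (Kzero p) (Omg p))]
  exact (_root_.map_ne_zero _).2 h1

theorem aCoef_ne_zero {F : Type} [Field F] (p n : ℕ) (hp : (p : F) ≠ 0) : aCoef F p n ≠ 0 :=
  mul_ne_zero (pow_ne_zero _ (neg_ne_zero.2 one_ne_zero)) (pow_ne_zero _ (neg_ne_zero.2 hp))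

theorem IsRatValuation.map_aCoef {F : Type} [Field F] {v : F → ℚ} (h : IsRatValuation v)
    {p : ℕ} (n : ℕ) (hp1 : 1 < p) (hp : (p : F) ≠ 0) (hvp : v p = 1) :
    v (aCoef F p n) = (p : ℚ) * ((p : ℚ) ^ n - 1) / ((p : ℚ) - 1) := by
  have hne : (-1 : F) ≠ 0 := neg_ne_zero.2 one_ne_zero
  have hp1' : (p : ℚ) ≠ 1 := by exact_mod_cast hp1.ne'
  rw [aCoef, h.map_mul _ _ (pow_ne_zero _ hne) (pow_ne_zero _ (neg_ne_zero.2 hp)),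
    h.map_pow hne, h.map_pow (neg_ne_zero.2 hp), h.map_neg hp, h.map_neg one_ne_zero, h.map_one,
    hvp]
  push_cast
  simp_rw [pow_succ]
  rw [← Finset.sum_mul, geom_sum_eq hp1']
  ring

/-- if `0 ≤ v(c) < p/((q+1)(p−1))`, then every root `y` of `L_c` satisfies
`v(c+y) = v(c)` and `v(y) = (v(a_n) + v(c))/q² = (p(q−1)/(p−1) + v(c))/q² > 0`. -/
theorem stmt_3 (p n : ℕ) [Fact p.Prime] (hn : 1 ≤ n)
    (v : Omg p → ℚ)
    (hv_mul : ∀ x y : Omg p, x ≠ 0 → y ≠ 0 → v (x * y) = v x + v y)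
    (hv_add : ∀ x y : Omg p, x ≠ 0 → y ≠ 0 → x + y ≠ 0 → min (v x) (v y) ≤ v (x + y))
    (hv_p : v ((p : ℕ) : Omg p) = 1)
    (hv_W : ∀ x : WittVector p (AlgebraicClosure (ZMod p)), x ≠ 0 →
      0 ≤ v (algebraMap (Kzero p) (Omg p)
        (algebraMap (WittVector p (AlgebraicClosure (ZMod p))) (Kzero p) x)))
    (c : Omg p) (hc0 : c ≠ 0) (hc_nonneg : 0 ≤ v c)
    (hc_lt : v c < (p : ℚ) / (((p : ℚ) ^ n + 1) * ((p : ℚ) - 1)))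
    (y : Omg p) (hy : (Lpoly (Omg p) p n c).IsRoot y) :
    v (c + y) = v c ∧ 0 < v y ∧
      v y = ((p : ℚ) * ((p : ℚ) ^ n - 1) / ((p : ℚ) - 1) + v c) / ((p : ℚ) ^ n * (p : ℚ) ^ n) := by
  have hp1 : 1 < p := (Fact.out : p.Prime).one_lt
  have hp1' : (0 : ℚ) < (p : ℚ) - 1 := sub_pos.2 (by exact_mod_cast hp1)
  have hp0 := natCast_Omg_ne_zero p
  have h : IsRatValuation v := ⟨hv_mul, hv_add⟩
  have ha0 := aCoef_ne_zero p n hp0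
  have hva := h.map_aCoef n hp1 hp0 hv_p
  have hq : 2 ≤ p ^ n := hp1.trans_le (Nat.le_self_pow (by omega) p)
  have hq' : (2 : ℚ) ≤ (p : ℚ) ^ n := by exact_mod_cast hq
  have he : y ^ (p ^ n * p ^ n) = aCoef (Omg p) p n * (c + y) *
      (1 + c * y ^ p ^ n + y ^ (p ^ n + 1)) ^ (p ^ n - 1) := by
    simpa [Lpoly, fqc, sub_eq_zero] using hy
  have hy0 : y ≠ 0 := by
    rintro rfl
    have hpn : p ^ n ≠ 0 := by omega
    rw [zero_pow (mul_ne_zero hpn hpn), zero_pow hpn, zero_pow (Nat.succ_ne_zero _), mul_zero,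
      add_zero, add_zero, add_zero, one_pow, mul_one] at he
    exact mul_ne_zero ha0 hc0 he.symm
  have ha : 0 < v (aCoef (Omg p) p n) := by
    rw [hva]
    exact div_pos (mul_pos (by linarith) (by linarith)) hp1'
  have hlt : (((p ^ n : ℕ) : ℚ) * (p ^ n : ℕ) - 1) * v c < v (aCoef (Omg p) p n) := by
    rw [hva]
    push_cast
    rw [lt_div_iff₀ (by positivity)] at hc_lt ⊢
    nlinarith
  obtain ⟨h1, h2, h3⟩ := h.map_of_pow_eq hq ha0 hc0 hy0 ha hc_nonneg hlt he
  refine ⟨h1, h2, ?_⟩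
  rw [eq_div_iff (by positivity), ← hva, ← h3]
  push_cast
  ring
end
end

section
/- Let p be a prime, n ≥ 1 and q = p^n. Let A ∈ 𝔪 (i.e. v(A) > 0) and let B ∈ O_Ω[T] be a polynomial all of whose coefficients have valuation ≥ 0. Then every coefficient of the polynomial (A + B)^q − (A^{p^{n−1}} + B^{p^{n−1}})^p ∈ Ω[T] lies in p²·𝔪, i.e. has valuation strictly greater than 2. -/
open Polynomial

noncomputable section

/-- The elements of nonnegative valuation in a field, as a subring. -/
def nonnegSubring {K : Type*} [Field K] (v : K → ℚ)
    (hv_mul : ∀ x y : K, x ≠ 0 → y ≠ 0 → v (x * y) = v x + v y)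
    (hv_add : ∀ x y : K, x ≠ 0 → y ≠ 0 → x + y ≠ 0 → min (v x) (v y) ≤ v (x + y)) :
    Subring K where
  carrier := {x | x = 0 ∨ 0 ≤ v x}
  zero_mem' := Or.inl rfl
  one_mem' := by
    have h := hv_mul 1 1 one_ne_zero one_ne_zero
    rw [mul_one] at h
    exact Or.inr (by linarith)
  mul_mem' := by
    intro x y hx hy
    by_cases hx0 : x = 0
    · exact Or.inl (by simp [hx0])
    by_cases hy0 : y = 0
    · exact Or.inl (by simp [hy0])
    have hx := hx.resolve_left hx0
    have hy := hy.resolve_left hy0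
    exact Or.inr (by rw [hv_mul x y hx0 hy0]; exact add_nonneg hx hy)
  add_mem' := by
    intro x y hx hy
    by_cases hx0 : x = 0
    · simpa [hx0] using hy
    by_cases hy0 : y = 0
    · simpa [hy0] using hx
    by_cases hxy : x + y = 0
    · exact Or.inl hxy
    exact Or.inr ((le_min (hx.resolve_left hx0) (hy.resolve_left hy0)).trans
      (hv_add x y hx0 hy0 hxy))
  neg_mem' := by
    intro x hx
    by_cases hx0 : x = 0
    · exact Or.inl (by simp [hx0])
    have h1 := hv_mul 1 1 one_ne_zero one_ne_zero
    have h2 := hv_mul (-1) (-1) (neg_ne_zero.mpr one_ne_zero) (neg_ne_zero.mpr one_ne_zero)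
    have h3 := hv_mul (-1) x (neg_ne_zero.mpr one_ne_zero) hx0
    have hx := hx.resolve_left hx0
    rw [mul_one] at h1
    rw [neg_mul_neg, mul_one] at h2
    rw [neg_one_mul] at h3
    exact Or.inr (by linarith)

/-- In a commutative ring, `(x + y) ^ p ^ (m + 1)` and `(x ^ p ^ m + y ^ p ^ m) ^ p` agree
modulo `p ^ 2 * x`. -/
theorem sq_mul_dvd_add_pow_sub_add_pow {R : Type*} [CommRing R] {p : ℕ} (hp : p.Prime)
    (x y : R) (m : ℕ) :
    (p : R) ^ 2 * x ∣ (x + y) ^ p ^ (m + 1) - (x ^ p ^ m + y ^ p ^ m) ^ p := by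
  obtain ⟨r, hr⟩ := exists_add_pow_prime_pow_eq hp x y m
  obtain ⟨s, hs⟩ := exists_add_pow_prime_eq hp (x ^ p ^ m + y ^ p ^ m) (p * x * y * r)
  obtain ⟨k, rfl⟩ := Nat.exists_eq_add_of_le hp.two_le
  rw [pow_succ (2 + k) m, pow_mul, hr, hs, pow_add (_ * r) 2 k]
  set P : R := ((2 + k : ℕ) : R)
  set S := x ^ (2 + k) ^ m + y ^ (2 + k) ^ m
  exact ⟨x * y ^ 2 * r ^ 2 * (P * x * y * r) ^ k + S * y * r * s, by ring⟩

/-- for `A ∈ 𝔪` and `B ∈ O_Ω[T]`, every coefficient of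
`(A + B)^q − (A^(p^(n−1)) + B^(p^(n−1)))^p` has valuation `> 2`, i.e. lies in `p²·𝔪`. -/
theorem stmt_4 (p n : ℕ) [Fact p.Prime] (hn : 1 ≤ n)
    (v : Omg p → ℚ)
    (hv_mul : ∀ x y : Omg p, x ≠ 0 → y ≠ 0 → v (x * y) = v x + v y)
    (hv_add : ∀ x y : Omg p, x ≠ 0 → y ≠ 0 → x + y ≠ 0 → min (v x) (v y) ≤ v (x + y))
    (hv_p : v ((p : ℕ) : Omg p) = 1)
    (hv_W : ∀ x : WittVector p (AlgebraicClosure (ZMod p)), x ≠ 0 →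
      0 ≤ v (algebraMap (Kzero p) (Omg p)
        (algebraMap (WittVector p (AlgebraicClosure (ZMod p))) (Kzero p) x)))
    (A : Omg p) (hA : A = 0 ∨ 0 < v A)
    (B : Polynomial (Omg p)) (hB : ∀ i, B.coeff i = 0 ∨ 0 ≤ v (B.coeff i)) :
    ∀ i, ((C A + B) ^ p ^ n - (C (A ^ p ^ (n - 1)) + B ^ p ^ (n - 1)) ^ p).coeff i = 0 ∨
      2 < v (((C A + B) ^ p ^ n - (C (A ^ p ^ (n - 1)) + B ^ p ^ (n - 1)) ^ p).coeff i) := by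
  intro i
  set O := nonnegSubring v hv_mul hv_add
  have hA' : A ∈ O := hA.imp_right le_of_lt
  obtain ⟨B', rfl⟩ : ∃ B' : Polynomial O, B'.map O.subtype = B := by
    have hlift : B ∈ Polynomial.lifts O.subtype :=
      (Polynomial.lifts_iff_coeff_lifts B).mpr fun j => ⟨⟨B.coeff j, hB j⟩, rfl⟩
    exact (Polynomial.mem_lifts B).mp hlift
  obtain ⟨m, rfl⟩ := Nat.exists_eq_add_of_le' hn
  obtain ⟨G, hG⟩ := sq_mul_dvd_add_pow_sub_add_pow (Fact.out : p.Prime)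
    (C (⟨A, hA'⟩ : O)) B' m
  have hD := congrArg (fun F => (F.map O.subtype).coeff i) hG
  have hcast : (p : Polynomial (Omg p)) ^ 2 * C A = C ((p : Omg p) ^ 2 * A) := by simp
  simp only [Polynomial.map_sub, Polynomial.map_pow, Polynomial.map_add, Polynomial.map_mul,
    Polynomial.map_C, Polynomial.map_natCast, Subring.subtype_apply, hcast,
    Polynomial.coeff_C_mul, Polynomial.coeff_map] at hD
  rw [Nat.add_sub_cancel, C_pow, hD]
  by_cases hp0 : (p : Omg p) = 0
  · exact Or.inl (by simp [hp0])
  by_cases hA0 : A = 0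
  · exact Or.inl (by simp [hA0])
  by_cases hG0 : (G.coeff i : Omg p) = 0
  · exact Or.inl (by simp [hG0])
  have hG' : 0 ≤ v (G.coeff i : Omg p) := (G.coeff i).2.resolve_left hG0
  have hA'' := hA.resolve_left hA0
  right
  rw [hv_mul _ _ (mul_ne_zero (pow_ne_zero 2 hp0) hA0) hG0, hv_mul _ _ (pow_ne_zero 2 hp0) hA0,
    sq, hv_mul _ _ hp0 hp0, hv_p]
  linarith
end
end

section
/- Assume 0 ≤ v(c) < p/((q+1)(p−1)), let y ∈ Ω be a root of L_c(X), and let s ∈ Ω satisfy s^{1+q} = λ^p (so v(s) = p/((q+1)(p−1))). Then every coefficient (as a polynomial in T) of the difference f_{q,c}(s·T + y) − [f_{q,c}(y) + y^q·s·T + (c+y)·s^q·T^q + s^{1+q}·T^{1+q}] ∈ Ω[T] has valuation strictly greater than p/(p−1); i.e. the difference lies in λ^p·𝔪[T]. -/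
open Polynomial

noncomputable section

set_option maxHeartbeats 1000000

/-- A function `v : K → ℚ` satisfying the laws of a valuation on the nonzero elements of `K`. -/
structure IsRatVal {K : Type*} [Field K] (v : K → ℚ) : Prop where
  mul : ∀ x y : K, x ≠ 0 → y ≠ 0 → v (x * y) = v x + v y
  add : ∀ x y : K, x ≠ 0 → y ≠ 0 → x + y ≠ 0 → min (v x) (v y) ≤ v (x + y)

namespace IsRatVal

variable {K : Type*} [Field K] {v : K → ℚ}

theorem map_one (h : IsRatVal v) : v 1 = 0 := by
  have := h.mul 1 1 one_ne_zero one_ne_zero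
  rw [mul_one] at this
  linarith

theorem map_neg (h : IsRatVal v) {x : K} (hx : x ≠ 0) : v (-x) = v x := by
  have h1 : (-1 : K) ≠ 0 := neg_ne_zero.2 one_ne_zero
  have h2 := h.mul (-1) (-1) h1 h1
  have h3 := h.mul (-1) x h1 hx
  rw [neg_mul_neg, mul_one, h.map_one] at h2
  rw [neg_one_mul] at h3
  linarith

theorem map_pow (h : IsRatVal v) {x : K} (hx : x ≠ 0) (m : ℕ) : v (x ^ m) = m * v x := by
  induction m with
  | zero => simp [h.map_one]
  | succ m ih =>
    rw [pow_succ, h.mul _ _ (pow_ne_zero _ hx) hx, ih]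
    push_cast
    ring

theorem le_add (h : IsRatVal v) {b : ℚ} {x y : K} (hx : x ≠ 0 → b ≤ v x) (hy : y ≠ 0 → b ≤ v y)
    (hxy : x + y ≠ 0) : b ≤ v (x + y) := by
  by_cases hx0 : x = 0
  · subst hx0
    rw [zero_add] at hxy ⊢
    exact hy hxy
  by_cases hy0 : y = 0
  · subst hy0
    rw [add_zero] at hxy ⊢
    exact hx hxy
  exact (le_min (hx hx0) (hy hy0)).trans (h.add x y hx0 hy0 hxy)

theorem natCast_nonneg (h : IsRatVal v) (m : ℕ) (hm : (m : K) ≠ 0) : 0 ≤ v (m : K) := by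
  induction m with
  | zero => simp at hm
  | succ m ih =>
    rw [Nat.cast_succ] at hm ⊢
    exact h.le_add ih (fun _ => h.map_one.ge) hm

theorem one_le_natCast (h : IsRatVal v) {p m : ℕ} (hp : v (p : K) = 1) (hpm : p ∣ m)
    (hm : (m : K) ≠ 0) : 1 ≤ v (m : K) := by
  obtain ⟨k, rfl⟩ := hpm
  rw [Nat.cast_mul] at hm ⊢
  rw [h.mul _ _ (left_ne_zero_of_mul hm) (right_ne_zero_of_mul hm), hp]
  linarith [h.natCast_nonneg k (right_ne_zero_of_mul hm)]

theorem add_eq_left (h : IsRatVal v) {x y : K} (hx : x ≠ 0) (hxy : y ≠ 0 → v x < v y) :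
    x + y ≠ 0 ∧ v (x + y) = v x := by
  by_cases hy : y = 0
  · simp [hy, hx]
  have hlt := hxy hy
  have hne : x + y ≠ 0 := by
    intro h0
    rw [eq_neg_of_add_eq_zero_right h0, h.map_neg hx] at hlt
    exact hlt.false
  refine ⟨hne, le_antisymm ?_ (h.le_add (fun _ => le_rfl) (fun _ => hlt.le) hne)⟩
  have h1 := h.add (x + y) (-y) hne (neg_ne_zero.2 hy) (by simpa using hx)
  rw [add_neg_cancel_right, h.map_neg hy] at h1
  exact (min_le_iff.1 h1).resolve_right hlt.not_ge

theorem lt_add (h : IsRatVal v) {b : ℚ} {x y : K} (hx : x = 0 ∨ b < v x) (hy : y = 0 ∨ b < v y) :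
    x + y = 0 ∨ b < v (x + y) := by
  rcases hx with rfl | hx
  · rwa [zero_add]
  rcases hy with rfl | hy
  · rw [add_zero]
    exact .inr hx
  refine or_iff_not_imp_left.2 fun hne => ?_
  exact (lt_min hx hy).trans_le
    (h.le_add (fun _ => min_le_left _ _) (fun _ => min_le_right _ _) hne)

theorem lt_mul (h : IsRatVal v) {b : ℚ} {a x : K} (ha : a ≠ 0 → 0 ≤ v a) (hx : x = 0 ∨ b < v x) :
    a * x = 0 ∨ b < v (a * x) := by
  refine or_iff_not_imp_left.2 fun hne => ?_
  obtain ⟨ha0, hx0⟩ := mul_ne_zero_iff.1 hne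
  rw [h.mul a x ha0 hx0]
  linarith [ha ha0, hx.resolve_left hx0]

end IsRatVal

theorem sub_one_mul_sum_pow_succ (p n : ℕ) :
    ((p : ℚ) - 1) * ((Finset.sum (Finset.range n) fun i => p ^ (i + 1) : ℕ) : ℚ) =
      p * ((p : ℚ) ^ n - 1) := by
  induction n with
  | zero => simp
  | succ n ih =>
    rw [Finset.sum_range_succ, Nat.cast_add, mul_add, ih]
    push_cast
    ring

/-- `a_n` is nonzero, of valuation `p (pⁿ - 1) / (p - 1)`. -/
theorem IsRatVal.aCoef_ne_zero_and_map {R : Type} [Field R] {v : R → ℚ} (h : IsRatVal v)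
    {p n : ℕ} (hp0 : (p : R) ≠ 0) (hp : v (p : R) = 1) (hp1 : (1 : ℚ) < p) :
    aCoef R p n ≠ 0 ∧ v (aCoef R p n) = p * ((p : ℚ) ^ n - 1) / ((p : ℚ) - 1) := by
  have h1 : (-1 : R) ≠ 0 := neg_ne_zero.2 one_ne_zero
  have hn : (-(p : R)) ≠ 0 := neg_ne_zero.2 hp0
  refine ⟨mul_ne_zero (pow_ne_zero _ h1) (pow_ne_zero _ hn), ?_⟩
  rw [aCoef, h.mul _ _ (pow_ne_zero _ h1) (pow_ne_zero _ hn), h.map_pow h1, h.map_pow hn,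
    h.map_neg one_ne_zero, h.map_neg hp0, h.map_one, hp, ← sub_one_mul_sum_pow_succ]
  have : (p : ℚ) - 1 ≠ 0 := by linarith
  field_simp
  ring

/-- Position of the roots of `X^(Q²) - a (c + X) (1 + c X^Q + X^(Q+1))^(Q-1)` with respect to `v c`,
given that `v a = σ (Q² - 1)` and `v c < σ`. -/
theorem IsRatVal.root_bounds {K : Type*} [Field K] {v : K → ℚ} (h : IsRatVal v) {Q : ℕ}
    (hQ : 2 ≤ Q) {a c y : K} {σ : ℚ} (ha : a ≠ 0) (hva : v a = σ * ((Q : ℚ) ^ 2 - 1))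
    (hc : c ≠ 0) (hc0 : 0 ≤ v c) (hcσ : v c < σ)
    (hy : y ^ (Q * Q) = a * (c + y) * (1 + c * y ^ Q + y ^ (Q + 1)) ^ (Q - 1)) :
    y ≠ 0 ∧ v c < v y ∧ v y < σ ∧ σ * ((Q : ℚ) ^ 2 - 1) ≤ (Q : ℚ) ^ 2 * v y := by
  have hQ' : (2 : ℚ) ≤ Q := by exact_mod_cast hQ
  have hσ : 0 < σ := hc0.trans_lt hcσ
  have hva0 : 0 < σ * ((Q : ℚ) ^ 2 - 1) := mul_pos hσ (by nlinarith)
  have hy0 : y ≠ 0 := by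
    rintro rfl
    rw [zero_pow (by positivity), zero_pow (by omega), zero_pow (by omega)] at hy
    simp [ha, hc] at hy
  have hR := pow_ne_zero (Q * Q) hy0
  rw [hy] at hR
  have hcy := right_ne_zero_of_mul (left_ne_zero_of_mul hR)
  have hf : 1 + c * y ^ Q + y ^ (Q + 1) ≠ 0 := by
    intro h0
    rw [h0, zero_pow (by omega)] at hR
    simp at hR
  have hval := congrArg v hy
  rw [h.map_pow hy0, h.mul _ _ (mul_ne_zero ha hcy) (pow_ne_zero _ hf), h.mul _ _ ha hcy,
    h.map_pow hf, hva, Nat.cast_mul, Nat.cast_sub (by omega), Nat.cast_one] at hval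
  have hyQ : v (c * y ^ Q) = v c + Q * v y := by
    rw [h.mul _ _ hc (pow_ne_zero _ hy0), h.map_pow hy0]
  have hyQ1 : v (y ^ (Q + 1)) = (Q + 1) * v y := by
    rw [h.map_pow hy0]
    push_cast
    rfl
  have hypos : 0 < v y := by
    by_contra! hle
    have h1 : v y ≤ v (c + y) := h.le_add (fun _ => hle.trans hc0) (fun _ => le_rfl) hcy
    have h2 : (Q + 1) * v y ≤ v (1 + c * y ^ Q + y ^ (Q + 1)) := by
      refine h.le_add (h.le_add (fun _ => ?_) (fun _ => ?_)) (fun _ => hyQ1.ge) hf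
      · rw [h.map_one]
        nlinarith
      · rw [hyQ]
        linarith
    nlinarith [mul_le_mul_of_nonneg_left h2 (show (0 : ℚ) ≤ Q - 1 by linarith)]
  have hvf : v (1 + c * y ^ Q + y ^ (Q + 1)) = 0 := by
    rw [add_assoc, ← h.map_one]
    refine (h.add_eq_left one_ne_zero fun hne => ?_).2
    rw [h.map_one]
    refine lt_of_lt_of_le (b := (Q : ℚ) * v y) (by positivity)
      (h.le_add (fun _ => ?_) (fun _ => ?_) hne)
    · rw [hyQ]
      linarith
    · rw [hyQ1]
      linarith
  rw [hvf, mul_zero, add_zero] at hval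
  have hcy_lt : v c < v y := by
    by_contra! hle
    have h1 : v y ≤ v (c + y) := h.le_add (fun _ => hle) (fun _ => le_rfl) hcy
    have h2 : v y < σ := hle.trans_lt hcσ
    nlinarith [mul_lt_mul_of_pos_right h2 (show (0 : ℚ) < (Q : ℚ) ^ 2 - 1 by nlinarith)]
  rw [(h.add_eq_left hc fun _ => hcy_lt).2] at hval
  refine ⟨hy0, hcy_lt, ?_, by nlinarith⟩
  have : (Q : ℚ) ^ 2 * v y < (Q : ℚ) ^ 2 * σ := by nlinarith
  exact lt_of_mul_lt_mul_left this (by positivity)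

theorem coeff_linear_pow {R : Type*} [CommRing R] (s y : R) (Q k : ℕ) :
    ((C s * X + C y) ^ Q).coeff k = y ^ (Q - k) * (Q.choose k : R) * s ^ k := by
  have : (C s * X + C y) ^ Q = ((X + C y) ^ Q).comp (C s * X) := by simp
  rw [this, comp_C_mul_X_coeff, coeff_X_add_C_pow]

/-- The coefficients of the mixed part of `(s X + y)^Q`. -/
theorem coeff_mixed_linear_pow {R : Type*} [CommRing R] (s y : R) {Q : ℕ} (hQ : Q ≠ 0) (k : ℕ) :
    ((C s * X + C y) ^ Q - C (s ^ Q) * X ^ Q - C (y ^ Q)).coeff k =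
      if 0 < k ∧ k < Q then y ^ (Q - k) * (Q.choose k : R) * s ^ k else 0 := by
  rw [coeff_sub, coeff_sub, coeff_linear_pow, coeff_C_mul_X_pow, coeff_C]
  rcases Nat.eq_zero_or_pos k with rfl | hk
  · simp [hQ.symm]
  rcases lt_trichotomy k Q with hlt | rfl | hgt
  · simp [hk, hlt, hk.ne', hlt.ne]
  · simp [hQ]
  · simp [hk.ne', hgt.ne', hgt.le, hgt.not_gt, Nat.choose_eq_zero_of_lt hgt]

theorem fqc_comp_sub {R : Type} [CommRing R] (p n : ℕ) (c s y : R) :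
    (fqc R p n c).comp (C s * X + C y) -
        (C ((fqc R p n c).eval y) + C (y ^ p ^ n * s) * X +
          C ((c + y) * s ^ p ^ n) * X ^ p ^ n + C (s ^ (p ^ n + 1)) * X ^ (p ^ n + 1)) =
      C (c + y) * ((C s * X + C y) ^ p ^ n - C (s ^ p ^ n) * X ^ p ^ n - C (y ^ p ^ n)) +
      C s * (((C s * X + C y) ^ p ^ n - C (s ^ p ^ n) * X ^ p ^ n - C (y ^ p ^ n)) * X) := by
  simp only [fqc, add_comp, mul_comp, pow_comp, one_comp, C_comp, X_comp, eval_add, eval_mul,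
    eval_pow, eval_one, eval_C, eval_X, C_add, C_mul, C_pow, C_1]
  ring

/-- with `s^(1+q) = λ^p`, the Taylor-type expansion
`f_{q,c}(sT + y) ≡ f_{q,c}(y) + y^q·s·T + (c+y)·s^q·T^q + s^(1+q)·T^(1+q) mod λ^p·𝔪[T]`. -/
theorem stmt_5 (p n : ℕ) [Fact p.Prime] (hn : 1 ≤ n)
    (v : Omg p → ℚ)
    (hv_mul : ∀ x y : Omg p, x ≠ 0 → y ≠ 0 → v (x * y) = v x + v y)
    (hv_add : ∀ x y : Omg p, x ≠ 0 → y ≠ 0 → x + y ≠ 0 → min (v x) (v y) ≤ v (x + y))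
    (hv_p : v ((p : ℕ) : Omg p) = 1)
    (hv_W : ∀ x : WittVector p (AlgebraicClosure (ZMod p)), x ≠ 0 →
      0 ≤ v (algebraMap (Kzero p) (Omg p)
        (algebraMap (WittVector p (AlgebraicClosure (ZMod p))) (Kzero p) x)))
    (ζ : Omg p) (hζ : IsPrimitiveRoot ζ p) (hlam : v (ζ - 1) = 1 / ((p : ℚ) - 1))
    (c : Omg p) (hc0 : c ≠ 0) (hc_nonneg : 0 ≤ v c)
    (hc_lt : v c < (p : ℚ) / (((p : ℚ) ^ n + 1) * ((p : ℚ) - 1)))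
    (y : Omg p) (hy : (Lpoly (Omg p) p n c).IsRoot y)
    (s : Omg p) (hs : s ^ (p ^ n + 1) = (ζ - 1) ^ p) :
    ∀ D : Polynomial (Omg p),
      D = (fqc (Omg p) p n c).comp (C s * X + C y) -
        (C ((fqc (Omg p) p n c).eval y) + C (y ^ p ^ n * s) * X +
          C ((c + y) * s ^ p ^ n) * X ^ p ^ n + C (s ^ (p ^ n + 1)) * X ^ (p ^ n + 1)) →
      ∀ i, D.coeff i = 0 ∨ (p : ℚ) / ((p : ℚ) - 1) < v (D.coeff i) := by
  rintro D rfl i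
  have h : IsRatVal v := ⟨hv_mul, hv_add⟩
  have hpp : p.Prime := Fact.out
  have hp2 : (2 : ℚ) ≤ p := by exact_mod_cast hpp.two_le
  have hp1 : (0 : ℚ) < (p : ℚ) - 1 := by linarith
  have hpQ : p ≤ p ^ n := Nat.le_self_pow (by omega) p
  have hQ2 : 2 ≤ p ^ n := hpp.two_le.trans hpQ
  have hpn : ((p ^ n : ℕ) : ℚ) = (p : ℚ) ^ n := by push_cast; rfl
  have hpQ' : (p : ℚ) ≤ ((p ^ n : ℕ) : ℚ) := by exact_mod_cast hpQ
  have hp0 : ((p : ℕ) : Omg p) ≠ 0 := by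
    have h1 := WittVector.p_nonzero p (AlgebraicClosure (ZMod p))
    have h2 := (map_ne_zero_iff _ (IsFractionRing.injective
      (WittVector p (AlgebraicClosure (ZMod p))) (Kzero p))).2 h1
    have h3 := (map_ne_zero_iff _ (algebraMap (Kzero p) (Omg p)).injective).2 h2
    rwa [map_natCast, map_natCast] at h3
  obtain ⟨ha, hva⟩ := h.aCoef_ne_zero_and_map (n := n) hp0 hv_p (by linarith)
  have hζ1 : ζ - 1 ≠ 0 := sub_ne_zero.2 (hζ.ne_one hpp.one_lt)
  have hs0 : s ≠ 0 := by
    rintro rfl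
    rw [zero_pow (by omega)] at hs
    exact pow_ne_zero p hζ1 hs.symm
  have hvs := congrArg v hs
  rw [h.map_pow hs0, h.map_pow hζ1, hlam, Nat.cast_add, Nat.cast_one] at hvs
  rw [fqc_comp_sub]
  rw [Polynomial.IsRoot.def, Lpoly] at hy
  have hdvd : ∀ k, 0 < k → k < p ^ n → p ∣ (p ^ n).choose k := fun k hk hkn =>
    hpp.dvd_choose_pow hk.ne' hkn.ne
  simp only [fqc, eval_sub, eval_mul, eval_add, eval_pow, eval_one, eval_C, eval_X] at hy
  rw [← hpn] at hva hc_lt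
  generalize p ^ n = Q at *
  have hvs' : v s = (p : ℚ) / (((Q : ℚ) + 1) * ((p : ℚ) - 1)) := by
    field_simp at hvs ⊢
    linarith
  have hva' : v (aCoef (Omg p) p n) = v s * ((Q : ℚ) ^ 2 - 1) := by
    rw [hva, hvs']
    field_simp
    ring
  obtain ⟨hy0, hcy, hys, hyQ⟩ :=
    h.root_bounds hQ2 ha hva' hc0 hc_nonneg (hvs' ▸ hc_lt) (sub_eq_zero.1 hy)
  have hQvy : (p : ℚ) / (p - 1) - 1 ≤ Q * v y := by
    have h1 : (p : ℚ) * (Q - 1) / (p - 1) ≤ (Q : ℚ) ^ 2 * v y := by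
      rwa [← hva, hva']
    have h2 : (Q : ℚ) * (p / (p - 1) - 1) ≤ (p : ℚ) * (Q - 1) / (p - 1) := by
      rw [div_sub_one hp1.ne', mul_div_assoc', div_le_div_iff_of_pos_right hp1]
      nlinarith
    have h3 : (Q : ℚ) * (p / (p - 1) - 1) ≤ Q * (Q * v y) := by linarith
    exact le_of_mul_le_mul_left h3 (by linarith)
  have hE : ∀ k, ((C s * X + C y) ^ Q - C (s ^ Q) * X ^ Q - C (y ^ Q)).coeff k = 0 ∨
      (p : ℚ) / (p - 1) <
        v (((C s * X + C y) ^ Q - C (s ^ Q) * X ^ Q - C (y ^ Q)).coeff k) := by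
    intro k
    rw [coeff_mixed_linear_pow s y (by omega)]
    split_ifs with hk
    · refine or_iff_not_imp_left.2 fun hne => ?_
      have hch := right_ne_zero_of_mul (left_ne_zero_of_mul hne)
      rw [h.mul _ _ (left_ne_zero_of_mul hne) (pow_ne_zero _ hs0),
        h.mul _ _ (pow_ne_zero _ hy0) hch, h.map_pow hs0, h.map_pow hy0, Nat.cast_sub hk.2.le]
      have h1 := h.one_le_natCast hv_p (hdvd k hk.1 hk.2) hch
      have h2 : (0 : ℚ) < k := by exact_mod_cast hk.1
      nlinarith [mul_lt_mul_of_pos_left hys h2]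
    · exact .inl rfl
  rw [coeff_add, coeff_C_mul, coeff_C_mul]
  refine h.lt_add (h.lt_mul (fun hne => ?_) (hE i)) (h.lt_mul (fun _ => ?_) ?_)
  · exact h.le_add (fun _ => hc_nonneg) (fun _ => hc_nonneg.trans hcy.le) hne
  · exact (hc_nonneg.trans_lt (hcy.trans hys)).le
  · cases i with
    | zero => simp
    | succ k =>
      rw [coeff_mul_X]
      exact hE k
end
end

section
/- Assume c ∈ O_K with v(c^p − c) ≥ 1 and v(c) < p/((q+1)(p−1)) (these conditions force v(c) = 0). Then every root y ∈ Ω of L_c(X) satisfies v(y^{q²/p} − c·b_n) = (v(a_n) + v(y))/p = (q−1)(q²+1)/((p−1)·q²), where q²/p = p^{2n−1}. -/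
open Polynomial

noncomputable section

/-- `b_n = −(−p)^(1 + p + ⋯ + p^(n−1))`, so that `b_n^p = a_n`. -/
def bCoef (R : Type) [CommRing R] (p n : ℕ) : R :=
  -(-(p : R)) ^ (Finset.sum (Finset.range n) fun i => p ^ i)

/-- `v` restricts to an additive valuation on the nonzero elements of `F`
(its value at `0` is irrelevant). -/
structure IsVal {F : Type} [Field F] (v : F → ℚ) : Prop where
  map_mul : ∀ x y : F, x ≠ 0 → y ≠ 0 → v (x * y) = v x + v y
  min_le_add : ∀ x y : F, x ≠ 0 → y ≠ 0 → x + y ≠ 0 → min (v x) (v y) ≤ v (x + y)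

/-- `x` has valuation at least `r`, with `0` of infinite valuation. -/
def ValGe {F : Type} [Field F] (v : F → ℚ) (r : ℚ) (x : F) : Prop := x = 0 ∨ r ≤ v x

/-- `x` is nonzero of valuation `r`. -/
def ValEq {F : Type} [Field F] (v : F → ℚ) (r : ℚ) (x : F) : Prop := x ≠ 0 ∧ v x = r

section Valuation

variable {F : Type} [Field F] {v : F → ℚ} {r s : ℚ} {x y : F}

theorem ValEq.ge (h : ValEq v r x) : ValGe v r x := Or.inr h.2.ge

theorem ValGe.mono (h : ValGe v s x) (hrs : r ≤ s) : ValGe v r x :=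
  h.imp id hrs.trans

theorem ValEq.le_of_ge (h : ValEq v r x) (h' : ValGe v s x) : s ≤ r := by
  rcases h' with h' | h'
  · exact absurd h' h.1
  · exact h'.trans h.2.le

theorem ValEq.unique (h : ValEq v r x) (h' : ValEq v s x) : r = s := h.2.symm.trans h'.2

namespace IsVal

theorem valEq_mul (hv : IsVal v) (hx : ValEq v r x) (hy : ValEq v s y) :
    ValEq v (r + s) (x * y) :=
  ⟨mul_ne_zero hx.1 hy.1, by rw [hv.map_mul x y hx.1 hy.1, hx.2, hy.2]⟩

theorem valEq_one (hv : IsVal v) : ValEq v 0 (1 : F) := by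
  refine ⟨one_ne_zero, ?_⟩
  have h := hv.map_mul 1 1 one_ne_zero one_ne_zero
  rw [mul_one] at h
  linarith

theorem valEq_neg_one (hv : IsVal v) : ValEq v 0 (-1 : F) := by
  refine ⟨neg_ne_zero.2 one_ne_zero, ?_⟩
  have h := hv.map_mul (-1) (-1) (neg_ne_zero.2 one_ne_zero) (neg_ne_zero.2 one_ne_zero)
  rw [neg_mul_neg, mul_one, hv.valEq_one.2] at h
  linarith

theorem valEq_neg (hv : IsVal v) (hx : ValEq v r x) : ValEq v r (-x) := by
  have h := hv.valEq_mul hv.valEq_neg_one hx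
  rwa [zero_add, neg_one_mul] at h

theorem valEq_pow (hv : IsVal v) (hx : ValEq v r x) (k : ℕ) : ValEq v (k * r) (x ^ k) := by
  induction k with
  | zero => simpa using hv.valEq_one
  | succ k ih =>
    have h := hv.valEq_mul ih hx
    rw [pow_succ]
    convert h using 1
    push_cast
    ring

theorem valGe_mul (hv : IsVal v) (hx : ValGe v r x) (hy : ValGe v s y) :
    ValGe v (r + s) (x * y) := by
  by_cases hx0 : x = 0
  · left; simp [hx0]
  by_cases hy0 : y = 0
  · left; simp [hy0]
  right
  rw [hv.map_mul x y hx0 hy0]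
  exact add_le_add (hx.resolve_left hx0) (hy.resolve_left hy0)

theorem valGe_neg (hv : IsVal v) (hx : ValGe v r x) : ValGe v r (-x) := by
  have h := hv.valGe_mul hv.valEq_neg_one.ge hx
  rwa [zero_add, neg_one_mul] at h

theorem valGe_pow (hv : IsVal v) (hx : ValGe v r x) (k : ℕ) : ValGe v (k * r) (x ^ k) := by
  induction k with
  | zero => simpa using hv.valEq_one.ge
  | succ k ih =>
    have h := hv.valGe_mul ih hx
    rw [pow_succ]
    convert h using 1
    push_cast
    ring

theorem valGe_add (hv : IsVal v) (hx : ValGe v r x) (hy : ValGe v r y) :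
    ValGe v r (x + y) := by
  by_cases hx0 : x = 0
  · simpa [hx0] using hy
  by_cases hy0 : y = 0
  · simpa [hy0] using hx
  by_cases hxy : x + y = 0
  · exact Or.inl hxy
  exact Or.inr ((le_min (hx.resolve_left hx0) (hy.resolve_left hy0)).trans
    (hv.min_le_add x y hx0 hy0 hxy))

theorem valGe_sub (hv : IsVal v) (hx : ValGe v r x) (hy : ValGe v r y) :
    ValGe v r (x - y) := by
  rw [sub_eq_add_neg]
  exact hv.valGe_add hx (hv.valGe_neg hy)

theorem valGe_sum (hv : IsVal v) {ι : Type} (t : Finset ι) (g : ι → F)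
    (h : ∀ i ∈ t, ValGe v r (g i)) : ValGe v r (∑ i ∈ t, g i) :=
  Finset.sum_induction g (ValGe v r) (fun _ _ => hv.valGe_add) (Or.inl rfl) h

theorem valGe_natCast (hv : IsVal v) (k : ℕ) : ValGe v 0 (k : F) := by
  induction k with
  | zero => left; simp
  | succ k ih =>
    rw [Nat.cast_succ]
    exact hv.valGe_add ih hv.valEq_one.ge

theorem valEq_add (hv : IsVal v) (hx : ValEq v r x) (hy : ValGe v s y) (hrs : r < s) :
    ValEq v r (x + y) := by
  have hne : x + y ≠ 0 := fun h => by
    rw [eq_neg_of_add_eq_zero_left h] at hx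
    exact absurd (hx.le_of_ge (hv.valGe_neg hy)) (not_le.2 hrs)
  have hge : ValGe v r (x + y) := hv.valGe_add hx.ge (hy.mono hrs.le)
  refine ⟨hne, le_antisymm ?_ (hge.resolve_left hne)⟩
  by_contra! hlt
  have h : ValGe v (min (v (x + y)) s) x := by
    have h' := hv.valGe_sub (ValGe.mono (Or.inr le_rfl) (min_le_left (v (x + y)) s))
      (hy.mono (min_le_right (v (x + y)) s))
    rwa [add_sub_cancel_right] at h'
  exact absurd (hx.le_of_ge h) (not_le.2 (lt_min hlt hrs))

theorem valGe_pow_sub_one (hv : IsVal v) (hr : 0 ≤ r) (hx : ValGe v r (x - 1)) (k : ℕ) :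
    ValGe v r (x ^ k - 1) := by
  have hx0 : ValGe v 0 x := by
    simpa using hv.valGe_add (hx.mono hr) hv.valEq_one.ge
  induction k with
  | zero => left; simp
  | succ k ih =>
    have h := hv.valGe_mul (hv.valGe_pow hx0 k) hx
    rw [mul_zero, zero_add] at h
    convert hv.valGe_add h ih using 1
    ring

/-- If `A ^ p - B ^ p` has valuation `w < p * β + v p`, then `A - B` has valuation `w / p`. -/
theorem valEq_sub_of_pow_sub_pow (hv : IsVal v) {p : ℕ} (hp : p.Prime)
    (hvp : ValEq v 1 (p : F)) {A B : F} {β w : ℚ} (hA : ValGe v β A) (hB : ValGe v β B)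
    (hw : ValEq v w (A ^ p - B ^ p)) (hlt : w < p * β + 1) :
    ValEq v (w / p) (A - B) := by
  have hp0 : (0 : ℚ) < p := by exact_mod_cast hp.pos
  obtain ⟨D, rfl⟩ : ∃ D, A = D + B := ⟨A - B, by ring⟩
  rw [add_sub_cancel_right]
  have hD0 : D ≠ 0 := by
    rintro rfl
    exact hw.1 (by simp)
  have hD : ValEq v (v D) D := ⟨hD0, rfl⟩
  have hβ : β ≤ v D := hD.le_of_ge (by simpa using hv.valGe_sub hA hB)
  have hcross : ValGe v (1 + (v D + (p - 1) * β)) ((p : F) *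
      ∑ k ∈ Finset.Ioo 0 p, D ^ k * B ^ (p - k) * ((p.choose k / p : ℕ) : F)) := by
    refine hv.valGe_mul hvp.ge (hv.valGe_sum _ _ fun k hk => ?_)
    rw [Finset.mem_Ioo] at hk
    refine (hv.valGe_mul (hv.valGe_mul (hv.valGe_pow hD.ge k) (hv.valGe_pow hB (p - k)))
      (hv.valGe_natCast _)).mono ?_
    rw [Nat.cast_sub hk.2.le]
    have hk1 : (1 : ℚ) ≤ k := by exact_mod_cast hk.1
    nlinarith
  have heq : (D + B) ^ p - B ^ p = D ^ p + (p : F) *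
      ∑ k ∈ Finset.Ioo 0 p, D ^ k * B ^ (p - k) * ((p.choose k / p : ℕ) : F) := by
    have hterm : ∑ k ∈ Finset.Ioo 0 p, D ^ k * B ^ (p - k) * ((p.choose k / p : ℕ) : F) =
        D * B * ∑ k ∈ Finset.Ioo 0 p,
          D ^ (k - 1) * B ^ (p - k - 1) * ((p.choose k / p : ℕ) : F) := by
      rw [Finset.mul_sum]
      refine Finset.sum_congr rfl fun k hk => ?_
      rw [Finset.mem_Ioo] at hk
      rw [← mul_pow_sub_one (by omega : k ≠ 0) D, ← mul_pow_sub_one (by omega : p - k ≠ 0) B]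
      ring
    rw [add_pow_prime_eq hp, hterm]
    ring
  rw [heq] at hw
  rcases lt_or_ge (p * v D) (1 + (v D + (p - 1) * β)) with h | h
  · refine ⟨hD0, ?_⟩
    have := hw.unique (hv.valEq_add (hv.valEq_pow hD p) hcross h)
    rw [this]
    field_simp
  · have := hw.le_of_ge (hv.valGe_add ((hv.valEq_pow hD p).ge.mono h) hcross)
    linarith

/-- The valuation of a root of `X ^ (q ^ 2) - a (c + X) (1 + c X ^ q + X ^ (q + 1)) ^ (q - 1)`. -/
theorem valEq_root (hv : IsVal v) {q : ℕ} (hq : 2 ≤ q) {a c : F} {α : ℚ} (hα : 0 < α)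
    (ha : ValEq v α a) (hc : ValEq v 0 c)
    (hy : y ^ (q * q) = a * (c + y) * (1 + c * y ^ q + y ^ (q + 1)) ^ (q - 1)) :
    ValEq v (α / (q * q)) y := by
  have hq0 : (0 : ℚ) < q := by exact_mod_cast (by omega : 0 < q)
  have hqc : ((q - 1 : ℕ) : ℚ) = q - 1 := by
    rw [Nat.cast_sub (by omega), Nat.cast_one]
  have hy0 : y ≠ 0 := by
    rintro rfl
    have hqq : q * q ≠ 0 := by positivity
    have hq' : q ≠ 0 := by omega
    rw [zero_pow hqq, zero_pow hq'] at hy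
    simp [ha.1, hc.1] at hy
  have hyv : ValEq v (v y) y := ⟨hy0, rfl⟩
  have hl := hv.valEq_pow hyv (q * q)
  rcases le_or_gt (v y) 0 with h | h
  · exfalso
    have hcy : ValGe v (v y) (c + y) := hv.valGe_add (hc.ge.mono h) hyv.ge
    have hf : ValGe v ((q + 1) * v y) (1 + c * y ^ q + y ^ (q + 1)) := by
      refine hv.valGe_add (hv.valGe_add (hv.valEq_one.ge.mono ?_)
        ((hv.valEq_mul hc (hv.valEq_pow hyv q)).ge.mono ?_))
        ((hv.valEq_pow hyv (q + 1)).ge.mono ?_)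
      · nlinarith
      · nlinarith
      · push_cast; exact le_rfl
    have hr := hv.valGe_mul (hv.valGe_mul ha.ge hcy) (hv.valGe_pow hf (q - 1))
    rw [← hy] at hr
    have := hl.le_of_ge hr
    rw [hqc] at this
    push_cast at this
    nlinarith
  · have hcy : ValEq v 0 (c + y) := hv.valEq_add hc hyv.ge h
    have hf : ValEq v 0 (1 + c * y ^ q + y ^ (q + 1)) := by
      have h1 : 1 + c * y ^ q + y ^ (q + 1) = 1 + y ^ q * (c + y) := by ring
      rw [h1]
      exact hv.valEq_add hv.valEq_one (hv.valEq_mul (hv.valEq_pow hyv q) hcy).ge (by positivity)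
    have hr := hv.valEq_mul (hv.valEq_mul ha hcy) (hv.valEq_pow hf (q - 1))
    rw [← hy] at hr
    have := hl.unique hr
    refine ⟨hy0, ?_⟩
    rw [eq_div_iff (by positivity)]
    push_cast at this
    linarith

/-- A root `y` satisfies `y ^ (q ^ 2) ≡ c ^ p a` up to an error of valuation `v a + v y`. -/
theorem valEq_root_pow_sub (hv : IsVal v) {q m : ℕ} (hq : 2 ≤ q) {a c : F} {α τ : ℚ}
    (hτ : 0 < τ) (hτ1 : τ < 1) (ha : ValEq v α a) (hc : ValEq v 0 c)
    (hcm : ValGe v 1 (c ^ m - c)) (hyv : ValEq v τ y)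
    (hy : y ^ (q * q) = a * (c + y) * (1 + c * y ^ q + y ^ (q + 1)) ^ (q - 1)) :
    ValEq v (α + τ) (y ^ (q * q) - c ^ m * a) := by
  have hcy : ValEq v 0 (c + y) := hv.valEq_add hc hyv.ge hτ
  have hq2 : (2 : ℚ) ≤ q := by exact_mod_cast hq
  have hf1 : ValGe v (q * τ) (1 + c * y ^ q + y ^ (q + 1) - 1) := by
    have h := hv.valEq_mul (hv.valEq_pow hyv q) hcy
    rw [add_zero] at h
    convert h.ge using 1
    ring
  have hpow := hv.valGe_pow_sub_one (by positivity) hf1 (q - 1)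
  have hsmall : ValGe v (min 1 (q * τ)) ((c + y) *
      ((1 + c * y ^ q + y ^ (q + 1)) ^ (q - 1) - 1) - (c ^ m - c)) := by
    refine hv.valGe_sub (ValGe.mono (hv.valGe_mul hcy.ge hpow) ?_)
      (hcm.mono (min_le_left _ _))
    rw [zero_add]
    exact min_le_right _ _
  have h := hv.valEq_mul ha (hv.valEq_add hyv hsmall (lt_min hτ1 (by nlinarith)))
  convert h using 1
  rw [hy]
  ring

/-- An element `c` with `0 ≤ v c < 1` and `v (c ^ p - c) ≥ 1` is a unit. -/
theorem valEq_zero_of_pow_sub_self (hv : IsVal v) {p : ℕ} (hp : 2 ≤ p) {c : F} (hc0 : c ≠ 0)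
    (hc : 0 ≤ v c) (hc1 : v c < 1) (hcp : ValGe v 1 (c ^ p - c)) : ValEq v 0 c := by
  refine ⟨hc0, ?_⟩
  by_contra hne
  have hpos : 0 < v c := lt_of_le_of_ne hc (Ne.symm hne)
  have hcv : ValEq v (v c) c := ⟨hc0, rfl⟩
  have hp' : (2 : ℚ) ≤ p := by exact_mod_cast hp
  have h := hv.valEq_add (hv.valEq_neg hcv) (hv.valEq_pow hcv p).ge (by nlinarith)
  rw [neg_add_eq_sub] at h
  linarith [h.le_of_ge hcp]

end IsVal

end Valuation

theorem bCoef_pow {R : Type} [CommRing R] {p n : ℕ} (hp : p.Prime) (hn : 1 ≤ n) :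
    bCoef R p n ^ p = aCoef R p n := by
  have hsign : (-1 : R) ^ p ^ n = (-1) ^ p := by
    rcases hp.eq_two_or_odd' with rfl | hodd
    · rw [Even.neg_one_pow (Even.pow_of_ne_zero even_two (by omega)),
        Even.neg_one_pow even_two]
    · rw [Odd.neg_one_pow hodd.pow, Odd.neg_one_pow hodd]
  rw [bCoef, aCoef, neg_pow, ← pow_mul, Finset.sum_mul, hsign]
  simp only [pow_succ]

theorem natCast_prime_ne_zero (p : ℕ) [Fact p.Prime] : (p : Omg p) ≠ 0 := by
  have h : (p : Kzero p) ≠ 0 := WittVector.FractionRing.p_nonzero p _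
  rw [← map_natCast (algebraMap (Kzero p) (Omg p))]
  exact (map_ne_zero_iff _ (algebraMap (Kzero p) (Omg p)).injective).2 h

set_option maxHeartbeats 1000000

/-- for `c ∈ O_K` with `v(c^p − c) ≥ 1` and `v(c) < p/((q+1)(p−1))`, every root `y`
of `L_c` satisfies `v(y^(q²/p) − c·b_n) = (v(a_n) + v(y))/p = (q−1)(q²+1)/((p−1)q²)`. -/
theorem stmt_8 (p n : ℕ) [Fact p.Prime] (hn : 1 ≤ n)
    (v : Omg p → ℚ)
    (hv_mul : ∀ x y : Omg p, x ≠ 0 → y ≠ 0 → v (x * y) = v x + v y)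
    (hv_add : ∀ x y : Omg p, x ≠ 0 → y ≠ 0 → x + y ≠ 0 → min (v x) (v y) ≤ v (x + y))
    (hv_p : v ((p : ℕ) : Omg p) = 1)
    (hv_W : ∀ x : WittVector p (AlgebraicClosure (ZMod p)), x ≠ 0 →
      0 ≤ v (algebraMap (Kzero p) (Omg p)
        (algebraMap (WittVector p (AlgebraicClosure (ZMod p))) (Kzero p) x)))
    (ζ : Omg p) (hζ : IsPrimitiveRoot ζ p)
    (μ : Omg p) (hμ : μ ^ (p ^ n + 1) = ζ - 1)
    (c : Omg p) (hcK : c ∈ IntermediateField.adjoin (Kzero p) {μ})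
    (hc0 : c ≠ 0) (hc_nonneg : 0 ≤ v c)
    (hcp : c ^ p - c = 0 ∨ 1 ≤ v (c ^ p - c))
    (hc_lt : v c < (p : ℚ) / (((p : ℚ) ^ n + 1) * ((p : ℚ) - 1)))
    (y : Omg p) (hy : (Lpoly (Omg p) p n c).IsRoot y) :
    v (y ^ p ^ (2 * n - 1) - c * bCoef (Omg p) p n) = (v (aCoef (Omg p) p n) + v y) / (p : ℚ) ∧
    v (y ^ p ^ (2 * n - 1) - c * bCoef (Omg p) p n) =
      ((p : ℚ) ^ n - 1) * ((p : ℚ) ^ (2 * n) + 1) / (((p : ℚ) - 1) * (p : ℚ) ^ (2 * n)) := by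
  have hp : p.Prime := Fact.out
  have hv : IsVal v := ⟨hv_mul, hv_add⟩
  have hvp : ValEq v 1 (p : Omg p) := ⟨natCast_prime_ne_zero p, hv_p⟩
  have hp2 : (2 : ℚ) ≤ p := by exact_mod_cast hp.two_le
  have hpq : p ≤ p ^ n := Nat.le_self_pow (by omega) p
  have hq : 2 ≤ p ^ n := hp.two_le.trans hpq
  have hpQ : (p : ℚ) ≤ (p : ℚ) ^ n := by exact_mod_cast hpq
  have hp1 : (0 : ℚ) < p - 1 := by linarith
  have hc1 : v c < 1 := by
    refine hc_lt.trans_le ((div_le_one (by positivity)).2 ?_)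
    nlinarith
  have hc := hv.valEq_zero_of_pow_sub_self hp.two_le hc0 hc_nonneg hc1 hcp
  have hsum : (∑ i ∈ Finset.range n, (p : ℚ) ^ i) = ((p : ℚ) ^ n - 1) / (p - 1) :=
    geom_sum_eq (by linarith) n
  have hb : ValEq v (((p : ℚ) ^ n - 1) / (p - 1)) (bCoef (Omg p) p n) := by
    have h := hv.valEq_neg (hv.valEq_pow (hv.valEq_neg hvp) (∑ i ∈ Finset.range n, p ^ i))
    push_cast at h
    rwa [hsum, mul_one] at h
  have ha : ValEq v (p * (((p : ℚ) ^ n - 1) / (p - 1))) (aCoef (Omg p) p n) := by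
    rw [← bCoef_pow hp hn]
    exact hv.valEq_pow hb p
  have hy' : y ^ (p ^ n * p ^ n) = aCoef (Omg p) p n * (c + y) *
      (1 + c * y ^ p ^ n + y ^ (p ^ n + 1)) ^ (p ^ n - 1) := by
    have h : (Lpoly (Omg p) p n c).eval y = 0 := hy
    simp only [Lpoly, fqc, eval_sub, eval_mul, eval_pow, eval_add, eval_X, eval_C, eval_one] at h
    exact sub_eq_zero.1 h
  have hα : 0 < (p : ℚ) * (((p : ℚ) ^ n - 1) / (p - 1)) :=
    mul_pos (by linarith) (div_pos (by linarith) hp1)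
  have hyv := hv.valEq_root hq hα ha hc hy'
  push_cast at hyv
  have hτ1 : (p : ℚ) * (((p : ℚ) ^ n - 1) / (p - 1)) / ((p : ℚ) ^ n * (p : ℚ) ^ n) < 1 := by
    rw [div_lt_one (by positivity), ← mul_div_assoc, div_lt_iff₀ hp1]
    nlinarith
  have hroot := hv.valEq_root_pow_sub hq (by positivity) hτ1 ha hc hcp hyv hy'
  have hexp : p ^ n * p ^ n = p ^ (2 * n - 1) * p := by
    rw [← pow_succ, ← pow_add]
    congr 1
    omega
  have hexpQ : (p : ℚ) ^ n * (p : ℚ) ^ n = (p : ℚ) ^ (2 * n - 1) * p := by exact_mod_cast hexp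
  have hA : ValEq v (((p : ℚ) ^ n - 1) / (p - 1)) (y ^ p ^ (2 * n - 1)) := by
    have h := hv.valEq_pow hyv (p ^ (2 * n - 1))
    push_cast at h
    rw [hexpQ] at h
    convert h using 1
    field_simp
  have hB := hv.valEq_mul hc hb
  rw [zero_add] at hB
  have hw : ValEq v (p * (((p : ℚ) ^ n - 1) / (p - 1)) +
      p * (((p : ℚ) ^ n - 1) / (p - 1)) / ((p : ℚ) ^ n * (p : ℚ) ^ n))
      ((y ^ p ^ (2 * n - 1)) ^ p - (c * bCoef (Omg p) p n) ^ p) := by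
    rw [mul_pow, bCoef_pow hp hn, ← pow_mul, ← hexp]
    exact hroot
  have hfin := hv.valEq_sub_of_pow_sub_pow hp hvp hA.ge hB.ge hw (by linarith)
  rw [hfin.2, ha.2, hyv.2]
  refine ⟨rfl, ?_⟩
  rw [two_mul, pow_add]
  field_simp
end
end
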